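/- arXiv:1706.04768 — 2 statements merged into one kernel-verified Lean document; each statement's English description precedes it below -/
import Mathlib

section
/- Let (τ, d, v, m_{A,I}) be smooth real-valued functions on an open subset of ℝ×ℝⁿ, with d = (d_α)_{α=1,…,m}, v = (v_i)_{i=1,…,n}, and m_{A,I} indexed by A ⊆ {1,…,m}, I ⊆ {1,…,n} with 1 ≤ |A| = |I| ≤ min{m,n}, with the convention m_{∅,∅} = τ, solving the non-conservative system: (i) ∂_t τ + v_j∂_jτ − τ∂_jv_j = 0; (ii) ∂_t d_α + v_i∂_i d_α + Σ_{A,I,i: α∈A, i∈I} (−1)^{O_A(α)+O_I(i)} m_{A∖{α},I∖{i}} ∂_i m_{A,I} = 0; (iii) ∂_t v_i + Σ_{A,I,j: j∈I, i∉I∖{j}} (−1)^{O_I(j)+O_{I∖{j}}(i)} m_{A,(I∖{j})∪{i}} ∂_j m_{A,I} − Σ_{A,I} m_{A,I}∂_i m_{A,I} + v_j∂_jv_i − τ∂_iτ = 0; (iv) ∂_t m_{A,I} + v_j∂_j m_{A,I} + Σ_{i,j: i∈I, j∉I∖{i}} (−1)^{O_{I∖{i}}(j)+O_I(i)} m_{A,(I∖{i})∪{j}}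 ∂_i v_j − m_{A,I}∂_jv_j + Σ_{α,i: α∈A, i∈I} (−1)^{O_A(α)+O_I(i)} m_{A∖{α},I∖{i}} ∂_i d_α = 0 (repeated indices summed). Assume τ never vanishes, and for 2 ≤ |I| = |A'|+1 ≤ min{m,n}+1 define σ_{A',I} = Σ_{i∈I} (−1)^{O_I(i)} ∂_i(τ⁻¹ m_{A',I∖{i}}), with the convention σ_{∅,{i}} = 0. Then σ_{A',I} satisfies ∂_t σ_{A',I} = − v_j∂_jσ_{A',I} + Σ_{α,i: α∈A', i∈I} (−1)^{O_{A'}(α)+O_I(i)} σ_{A'∖{α},I∖{i}} ∂_i d_α − Σ_{i,j: i∈I, j∉I∖{i}} (−1)^{O_{I∖{i}}(j)+O_I(i)} σ_{A',(I∖{i})∪{j}} ∂_i v_j. -/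
/-- `O_A(a)`: the number of elements of `A ∪ {a}` that are `≤ a`. -/
def ordIdx {N : ℕ} (A : Finset (Fin N)) (a : Fin N) : ℕ :=
  ((insert a A).filter (fun x => x ≤ a)).card

/-- Time derivative `∂_t f` of a function of `(t,x) ∈ ℝ × ℝⁿ`. -/
noncomputable def pt {n : ℕ} (f : ℝ × (Fin n → ℝ) → ℝ) (p : ℝ × (Fin n → ℝ)) : ℝ :=
  fderiv ℝ f p (1, 0)

/-- Spatial partial derivative `∂_i f` of a function of `(t,x) ∈ ℝ × ℝⁿ`. -/
noncomputable def px {n : ℕ} (i : Fin n) (f : ℝ × (Fin n → ℝ) → ℝ) (p : ℝ × (Fin n → ℝ)) : ℝ :=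
  fderiv ℝ f p (0, Pi.single i 1)

section ContDiff

variable {X V : Type*} [NormedAddCommGroup X] [NormedSpace ℝ X]
  [NormedAddCommGroup V] [NormedSpace ℝ V]

theorem ContDiffAt.fderiv_apply_const {f : X → V} {p : X} (hf : ContDiffAt ℝ (⊤ : ℕ∞) f p)
    (a : X) : ContDiffAt ℝ (⊤ : ℕ∞) (fun q => fderiv ℝ f q a) p :=
  (hf.fderiv_right (m := (⊤ : ℕ∞)) le_rfl).clm_apply contDiffAt_const

theorem ContDiffAt.differentiableAt_of_top {f : X → V} {p : X}
    (hf : ContDiffAt ℝ (⊤ : ℕ∞) f p) : DifferentiableAt ℝ f p :=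
  hf.differentiableAt (by simp)

theorem ContDiffAt.fderiv_fderiv_apply_comm {f : X → V} {p : X}
    (hf : ContDiffAt ℝ (⊤ : ℕ∞) f p) (a b : X) :
    fderiv ℝ (fun q => fderiv ℝ f q a) p b = fderiv ℝ (fun q => fderiv ℝ f q b) p a := by
  have h1 : DifferentiableAt ℝ (fderiv ℝ f) p :=
    (hf.fderiv_right (m := (⊤ : ℕ∞)) le_rfl).differentiableAt_of_top
  have h2 : IsSymmSndFDerivAt ℝ f p := hf.isSymmSndFDerivAt (by
    simp only [minSmoothness_of_isRCLikeNormedField]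
    exact WithTop.coe_le_coe.2 (le_top : (2 : ℕ∞) ≤ ⊤))
  have h3 : ∀ c e, fderiv ℝ (fun q => fderiv ℝ f q c) p e = fderiv ℝ (fderiv ℝ f) p e c := by
    intro c e
    rw [fderiv_clm_apply h1 (differentiableAt_const c)]
    simp
  rw [h3, h3]
  exact h2 b a

theorem fderiv_fun_clm_apply_const (L : V →L[ℝ] V) {f : X → V} {p : X}
    (hf : DifferentiableAt ℝ f p) (a : X) :
    fderiv ℝ (fun q => L (f q)) p a = L (fderiv ℝ f p a) := by
  have := (L.hasFDerivAt.comp p hf.hasFDerivAt).fderiv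
  simp only [Function.comp_def] at this
  rw [this]; rfl

theorem fderiv_fun_smul_apply {g : X → ℝ} {f : X → V} {p : X}
    (hg : DifferentiableAt ℝ g p) (hf : DifferentiableAt ℝ f p) (a : X) :
    fderiv ℝ (fun q => g q • f q) p a = g p • fderiv ℝ f p a + fderiv ℝ g p a • f p := by
  rw [fderiv_fun_smul hg hf]; simp

theorem fderiv_fun_add_apply {f g : X → V} {p : X}
    (hf : DifferentiableAt ℝ f p) (hg : DifferentiableAt ℝ g p) (a : X) :
    fderiv ℝ (fun q => f q + g q) p a = fderiv ℝ f p a + fderiv ℝ g p a := by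
  rw [fderiv_fun_add hf hg]; simp

theorem fderiv_fun_sum_apply {ι : Type*} {s : Finset ι} {f : ι → X → V} {p : X}
    (hf : ∀ i ∈ s, DifferentiableAt ℝ (f i) p) (a : X) :
    fderiv ℝ (fun q => ∑ i ∈ s, f i q) p a = ∑ i ∈ s, fderiv ℝ (f i) p a := by
  rw [fderiv_fun_sum hf]; simp

/-- If `E` and `C` satisfy the canonical anticommutation relations (exterior multiplication and
contraction), the `d`-operator `∑ k, E k ∘ ∂_k` commutes with the Lie transport by `v`, up to the
exterior products with the exact forms `∑ i, ∂_i d_α E i`. -/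
theorem exteriorDeriv_transport {ι κ : Type*} [Fintype ι] [Fintype κ] [DecidableEq ι]
    (E C : ι → V →L[ℝ] V)
    (hEE : ∀ i j x, E i (E j x) = - E j (E i x))
    (hCE : ∀ i j x, C j (E i x) + E i (C j x) = if i = j then x else 0)
    {Ω : Set X} (hΩ : IsOpen Ω) (e₀ : X) (e : ι → X)
    (v : ι → X → ℝ) (d : κ → X → ℝ) (w : X → V) (u : κ → X → V)
    (hv : ∀ i, ContDiffOn ℝ (⊤ : ℕ∞) (v i) Ω)
    (hd : ∀ α, ContDiffOn ℝ (⊤ : ℕ∞) (d α) Ω)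
    (hw : ContDiffOn ℝ (⊤ : ℕ∞) w Ω)
    (hu : ∀ α, ContDiffOn ℝ (⊤ : ℕ∞) (u α) Ω)
    (H : ∀ q ∈ Ω, fderiv ℝ w q e₀ + ∑ j, v j q • fderiv ℝ w q (e j)
      + ∑ i, ∑ j, fderiv ℝ (v j) q (e i) • E i (C j (w q))
      + ∑ α, ∑ i, fderiv ℝ (d α) q (e i) • E i (u α q) = 0)
    {p : X} (hp : p ∈ Ω) :
    fderiv ℝ (fun q => ∑ k, E k (fderiv ℝ w q (e k))) p e₀
      = - ∑ j, v j p • fderiv ℝ (fun q => ∑ k, E k (fderiv ℝ w q (e k))) p (e j)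
      + ∑ α, ∑ i, fderiv ℝ (d α) p (e i) • E i (∑ k, E k (fderiv ℝ (u α) p (e k)))
      - ∑ i, ∑ j, fderiv ℝ (v j) p (e i) • E i (C j (∑ k, E k (fderiv ℝ w p (e k)))) := by
  have hΩp : Ω ∈ nhds p := hΩ.mem_nhds hp
  replace hv := fun i => (hv i).contDiffAt hΩp
  replace hd := fun i => (hd i).contDiffAt hΩp
  replace hw := hw.contDiffAt hΩp
  replace hu := fun i => (hu i).contDiffAt hΩp
  have hw1 := hw.differentiableAt_of_top
  have hw2 := fun a => (hw.fderiv_apply_const a).differentiableAt_of_top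
  have hv1 := fun i => (hv i).differentiableAt_of_top
  have hv2 := fun i a => ((hv i).fderiv_apply_const a).differentiableAt_of_top
  have hd2 := fun i a => ((hd i).fderiv_apply_const a).differentiableAt_of_top
  have hu1 := fun i => (hu i).differentiableAt_of_top
  have hL : ∀ (L : V →L[ℝ] V) {f : X → V}, DifferentiableAt ℝ f p →
      DifferentiableAt ℝ (fun q => L (f q)) p := fun L f hf =>
    L.differentiableAt.comp p hf
  have hS : ∀ a, fderiv ℝ (fun q => ∑ k, E k (fderiv ℝ w q (e k))) p a
      = ∑ k, E k (fderiv ℝ (fun q => fderiv ℝ w q a) p (e k)) := by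
    intro a
    rw [fderiv_fun_sum_apply (fun k _ => hL _ (hw2 _))]
    refine Finset.sum_congr rfl fun k _ => ?_
    rw [fderiv_fun_clm_apply_const _ (hw2 _), hw.fderiv_fderiv_apply_comm]
  have hT2 : ∀ j, DifferentiableAt ℝ (fun q => v j q • fderiv ℝ w q (e j)) p :=
    fun j => (hv1 j).smul (hw2 _)
  have hT3 : ∀ i j, DifferentiableAt ℝ
      (fun q => fderiv ℝ (v j) q (e i) • E i (C j (w q))) p :=
    fun i j => (hv2 j _).smul (hL (E i) (hL (C j) hw1))
  have hT4 : ∀ α i, DifferentiableAt ℝ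
      (fun q => fderiv ℝ (d α) q (e i) • E i (u α q)) p :=
    fun α i => (hd2 α _).smul (hL (E i) (hu1 α))
  have hT3' : ∀ i, DifferentiableAt ℝ
      (fun q => ∑ j, fderiv ℝ (v j) q (e i) • E i (C j (w q))) p :=
    fun i => DifferentiableAt.fun_sum fun j _ => hT3 i j
  have hT4' : ∀ α, DifferentiableAt ℝ
      (fun q => ∑ i, fderiv ℝ (d α) q (e i) • E i (u α q)) p :=
    fun i => DifferentiableAt.fun_sum fun j _ => hT4 i j
  have hdiff : ∀ a, fderiv ℝ (fun q => fderiv ℝ w q e₀) p a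
      + ∑ j, (v j p • fderiv ℝ (fun q => fderiv ℝ w q (e j)) p a
          + fderiv ℝ (v j) p a • fderiv ℝ w p (e j))
      + ∑ i, ∑ j, (fderiv ℝ (v j) p (e i) • E i (C j (fderiv ℝ w p a))
          + fderiv ℝ (fun q => fderiv ℝ (v j) q (e i)) p a • E i (C j (w p)))
      + ∑ α, ∑ i, (fderiv ℝ (d α) p (e i) • E i (fderiv ℝ (u α) p a)
          + fderiv ℝ (fun q => fderiv ℝ (d α) q (e i)) p a • E i (u α p)) = 0 := by
    intro a
    have h0 : (fun q => fderiv ℝ w q e₀ + ∑ j, v j q • fderiv ℝ w q (e j)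
        + ∑ i, ∑ j, fderiv ℝ (v j) q (e i) • E i (C j (w q))
        + ∑ α, ∑ i, fderiv ℝ (d α) q (e i) • E i (u α q)) =ᶠ[nhds p] fun _ => 0 :=
      Filter.eventually_of_mem hΩp H
    have h1 := congrArg (fun L : X →L[ℝ] V => L a) h0.fderiv_eq
    simp only [fderiv_fun_const, Pi.zero_apply, zero_apply] at h1
    have hs2 : DifferentiableAt ℝ (fun q => ∑ j, v j q • fderiv ℝ w q (e j)) p :=
      DifferentiableAt.fun_sum fun j _ => hT2 j
    have hs3 : DifferentiableAt ℝ
        (fun q => ∑ i, ∑ j, fderiv ℝ (v j) q (e i) • E i (C j (w q))) p :=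
      DifferentiableAt.fun_sum fun i _ => hT3' i
    have hs4 : DifferentiableAt ℝ
        (fun q => ∑ α, ∑ i, fderiv ℝ (d α) q (e i) • E i (u α q)) p :=
      DifferentiableAt.fun_sum fun α _ => hT4' α
    rw [fderiv_fun_add_apply (((hw2 e₀).fun_add hs2).fun_add hs3) hs4,
      fderiv_fun_add_apply ((hw2 e₀).fun_add hs2) hs3, fderiv_fun_add_apply (hw2 e₀) hs2] at h1
    rw [fderiv_fun_sum_apply (fun j _ => hT2 j), fderiv_fun_sum_apply (fun i _ => hT3' i),
      fderiv_fun_sum_apply (fun i _ => hT4' i)] at h1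
    rw [← h1]
    congr 1
    · congr 1
      · congr 1
        exact Finset.sum_congr rfl fun j _ => (fderiv_fun_smul_apply (hv1 j) (hw2 _) a).symm
      · refine Finset.sum_congr rfl fun i _ => ?_
        rw [fderiv_fun_sum_apply (fun j _ => hT3 i j)]
        refine Finset.sum_congr rfl fun j _ => ?_
        rw [fderiv_fun_smul_apply (hv2 j _) (hL (E i) (hL (C j) hw1)),
          fderiv_fun_clm_apply_const _ (hL (C j) hw1), fderiv_fun_clm_apply_const _ hw1]
    · refine Finset.sum_congr rfl fun α _ => ?_
      rw [fderiv_fun_sum_apply (fun i _ => hT4 α i)]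
      refine Finset.sum_congr rfl fun i _ => ?_
      rw [fderiv_fun_smul_apply (hd2 α _) (hL (E i) (hu1 α)),
        fderiv_fun_clm_apply_const _ (hu1 α)]
  have hanti : ∀ (s : ι → ι → ℝ) (x : V), (∀ i k, s i k = s k i) →
      ∑ k, ∑ i, s i k • E k (E i x) = 0 := by
    intro s x hs
    have h : ∑ k, ∑ i, s i k • E k (E i x) = - ∑ k, ∑ i, s i k • E k (E i x) := by
      conv_lhs => rw [Finset.sum_comm]
      simp only [← Finset.sum_neg_distrib]
      refine Finset.sum_congr rfl fun k _ => Finset.sum_congr rfl fun i _ => ?_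
      rw [hEE i k, hs, smul_neg]
    have h2 : (2 : ℝ) • ∑ k, ∑ i, s i k • E k (E i x) = 0 := by
      rw [two_smul]
      nth_rewrite 1 [h]
      exact neg_add_cancel _
    exact (smul_eq_zero.mp h2).resolve_left two_ne_zero
  have hV : ∑ k, ∑ i, ∑ j, fderiv ℝ (fun q => fderiv ℝ (v j) q (e i)) p (e k) •
      E k (E i (C j (w p))) = 0 := by
    calc _ = ∑ j, ∑ k, ∑ i, fderiv ℝ (fun q => fderiv ℝ (v j) q (e i)) p (e k) •
          E k (E i (C j (w p))) :=
          (Finset.sum_congr rfl fun k _ => Finset.sum_comm).trans Finset.sum_comm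
      _ = 0 := Finset.sum_eq_zero fun j _ =>
          hanti _ _ fun i k => (hv j).fderiv_fderiv_apply_comm _ _
  have hD : ∑ k, ∑ α, ∑ i, fderiv ℝ (fun q => fderiv ℝ (d α) q (e i)) p (e k) •
      E k (E i (u α p)) = 0 := by
    rw [Finset.sum_comm]
    exact Finset.sum_eq_zero fun α _ =>
      hanti _ _ fun i k => (hd α).fderiv_fderiv_apply_comm _ _
  have hsum := Finset.sum_eq_zero (s := Finset.univ) fun k _ =>
    (congrArg (E k) (hdiff (e k))).trans (map_zero (E k))
  simp only [map_add, map_sum, map_smul, Finset.sum_add_distrib, hV, hD, add_zero] at hsum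
  have hA : ∑ k, ∑ j, fderiv ℝ (v j) p (e k) • E k (fderiv ℝ w p (e j))
      + ∑ k, ∑ i, ∑ j, fderiv ℝ (v j) p (e i) • E k (E i (C j (fderiv ℝ w p (e k))))
      = ∑ i, ∑ j, fderiv ℝ (v j) p (e i) • E i (C j (∑ k, E k (fderiv ℝ w p (e k)))) := by
    have h : ∑ k, ∑ i, ∑ j, fderiv ℝ (v j) p (e i) • E k (E i (C j (fderiv ℝ w p (e k))))
        = ∑ i, ∑ j, ∑ k, fderiv ℝ (v j) p (e i) • E k (E i (C j (fderiv ℝ w p (e k)))) := by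
      rw [Finset.sum_comm]
      exact Finset.sum_congr rfl fun i _ => Finset.sum_comm
    rw [h, ← Finset.sum_add_distrib]
    refine Finset.sum_congr rfl fun i _ => ?_
    rw [← Finset.sum_add_distrib]
    refine Finset.sum_congr rfl fun j _ => ?_
    rw [← Finset.smul_sum, ← smul_add]
    congr 1
    have h2 : ∀ k, E k (E i (C j (fderiv ℝ w p (e k)))) =
        E i (C j (E k (fderiv ℝ w p (e k)))) - if k = j then E i (fderiv ℝ w p (e k)) else 0 := by
      intro k
      rw [hEE, eq_sub_of_add_eq' (hCE k j _)]
      split_ifs <;> simp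
    simp only [h2, map_sum, Finset.sum_sub_distrib]
    simp
  have hB : ∑ k, ∑ α, ∑ i, fderiv ℝ (d α) p (e i) • E k (E i (fderiv ℝ (u α) p (e k)))
      = - ∑ α, ∑ i, fderiv ℝ (d α) p (e i) • E i (∑ k, E k (fderiv ℝ (u α) p (e k))) := by
    rw [Finset.sum_comm, ← Finset.sum_neg_distrib]
    refine Finset.sum_congr rfl fun α _ => ?_
    rw [Finset.sum_comm, ← Finset.sum_neg_distrib]
    refine Finset.sum_congr rfl fun i _ => ?_
    rw [map_sum, Finset.smul_sum, ← Finset.sum_neg_distrib]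
    refine Finset.sum_congr rfl fun k _ => ?_
    rw [hEE, smul_neg]
  have hF : ∑ k, ∑ j, v j p • E k (fderiv ℝ (fun q => fderiv ℝ w q (e j)) p (e k))
      = ∑ j, v j p • ∑ k, E k (fderiv ℝ (fun q => fderiv ℝ w q (e j)) p (e k)) := by
    rw [Finset.sum_comm]
    simp only [Finset.smul_sum]
  simp only [hS]
  rw [hB, hF] at hsum
  rw [← hA]
  rw [← sub_eq_zero]
  rw [← hsum]
  abel

end ContDiff

section WedgeContract

theorem ordIdx_eq_erase_add {N : ℕ} {I : Finset (Fin N)} {i j : Fin N} (hi : i ∈ I)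
    (hij : i ≠ j) : ordIdx I j = ordIdx (I.erase i) j + if i < j then 1 else 0 := by
  unfold ordIdx
  have h : insert j (I.erase i) = (insert j I).erase i := by
    rw [Finset.erase_insert_of_ne hij.symm]
  rw [h, Finset.filter_erase]
  split_ifs with hlt
  · rw [Finset.card_erase_add_one]
    simp [hi, hlt.le]
  · rw [Finset.erase_eq_of_notMem, add_zero]
    simp only [Finset.mem_filter, not_and]
    intro _ hle
    exact hlt (lt_of_le_of_ne hle hij)

theorem ordIdx_insert_self {N : ℕ} (I : Finset (Fin N)) (i : Fin N) :
    ordIdx (insert i I) i = ordIdx I i := by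
  simp [ordIdx]

theorem ordIdx_erase_self {N : ℕ} {I : Finset (Fin N)} {i : Fin N} (hi : i ∈ I) :
    ordIdx (I.erase i) i = ordIdx I i := by
  simp [ordIdx, hi]

/-- Exterior multiplication by `dx_i` on forms given by their coefficients, up to sign. -/
noncomputable def wedgeOp {n : ℕ} (i : Fin n) :
    (Finset (Fin n) → ℝ) →L[ℝ] (Finset (Fin n) → ℝ) :=
  LinearMap.toContinuousLinearMap
    { toFun := fun W I => if i ∈ I then (-1) ^ ordIdx I i * W (I.erase i) else 0
      map_add' := fun W W' => by
        ext I; by_cases h : i ∈ I <;> simp [h, mul_add]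
      map_smul' := fun c W => by
        ext I; by_cases h : i ∈ I <;> simp [h, mul_left_comm] }

/-- Contraction with `∂_j` on forms given by their coefficients, up to sign. -/
noncomputable def contractOp {n : ℕ} (j : Fin n) :
    (Finset (Fin n) → ℝ) →L[ℝ] (Finset (Fin n) → ℝ) :=
  LinearMap.toContinuousLinearMap
    { toFun := fun W I => if j ∉ I then (-1) ^ ordIdx I j * W (insert j I) else 0
      map_add' := fun W W' => by
        ext I; by_cases h : j ∈ I <;> simp [h, mul_add]
      map_smul' := fun c W => by
        ext I; by_cases h : j ∈ I <;> simp [h, mul_left_comm] }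

theorem wedgeOp_apply {n : ℕ} (i : Fin n) (W : Finset (Fin n) → ℝ) (I : Finset (Fin n)) :
    wedgeOp i W I = if i ∈ I then (-1) ^ ordIdx I i * W (I.erase i) else 0 := rfl

theorem contractOp_apply {n : ℕ} (j : Fin n) (W : Finset (Fin n) → ℝ) (I : Finset (Fin n)) :
    contractOp j W I = if j ∉ I then (-1) ^ ordIdx I j * W (insert j I) else 0 := rfl

theorem wedgeOp_anticomm {n : ℕ} (i j : Fin n) (W : Finset (Fin n) → ℝ) :
    wedgeOp i (wedgeOp j W) = - wedgeOp j (wedgeOp i W) := by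
  ext I
  simp only [wedgeOp_apply, Pi.neg_apply, Finset.mem_erase]
  by_cases hij : i = j
  · subst hij; simp
  by_cases hi : i ∈ I
  swap
  · simp [hi]
  by_cases hj : j ∈ I
  swap
  · simp [hj]
  simp only [hi, hj, hij, Ne.symm hij, ne_eq, not_false_eq_true, and_self, if_true]
  rw [ordIdx_eq_erase_add hi hij, ordIdx_eq_erase_add hj (Ne.symm hij),
    Finset.erase_right_comm]
  rcases lt_or_gt_of_ne hij with h | h <;> simp [h, h.not_gt, pow_succ] <;> ring

theorem contractOp_wedgeOp_add {n : ℕ} (i j : Fin n) (W : Finset (Fin n) → ℝ) :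
    contractOp j (wedgeOp i W) + wedgeOp i (contractOp j W) = if i = j then W else 0 := by
  ext I
  simp only [wedgeOp_apply, contractOp_apply, Pi.add_apply, Finset.mem_erase, Finset.mem_insert]
  by_cases hij : i = j
  · subst hij
    by_cases hi : i ∈ I
    · simp [hi, ordIdx_erase_self hi, ← mul_assoc, ← mul_pow]
    · simp [hi, ordIdx_insert_self, ← mul_assoc, ← mul_pow]
  by_cases hi : i ∈ I
  swap
  · simp [hi, hij]
  by_cases hj : j ∈ I
  · simp [hj, hij, Ne.symm hij]
  have h1 : ordIdx (insert j I) i = ordIdx I i + if j < i then 1 else 0 := by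
    rw [ordIdx_eq_erase_add (Finset.mem_insert_self j I) (Ne.symm hij), Finset.erase_insert hj]
  simp only [hi, hj, hij, or_true, and_false, not_false_eq_true, if_true, if_false, Pi.zero_apply]
  rw [ordIdx_eq_erase_add hi hij, h1, Finset.erase_insert_of_ne (Ne.symm hij)]
  rcases lt_or_gt_of_ne hij with h | h <;> simp [h, h.not_gt, pow_succ] <;> ring

end WedgeContract

theorem fderiv_apply_coord {X J : Type*} [NormedAddCommGroup X] [NormedSpace ℝ X] [Fintype J]
    {f : X → J → ℝ} {p : X} (hf : DifferentiableAt ℝ f p) (a : X) (j : J) :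
    fderiv ℝ f p a j = fderiv ℝ (fun q => f q j) p a := by
  rw [fderiv_pi (differentiableAt_pi.1 hf)]
  rfl

theorem fderiv_inv_mul_apply {X : Type*} [NormedAddCommGroup X] [NormedSpace ℝ X]
    {f g : X → ℝ} {p : X} (hf : DifferentiableAt ℝ f p) (hg : DifferentiableAt ℝ g p)
    (h0 : f p ≠ 0) (a : X) :
    fderiv ℝ (fun q => (f q)⁻¹ * g q) p a =
      (f p)⁻¹ * fderiv ℝ g p a - (f p)⁻¹ ^ 2 * fderiv ℝ f p a * g p := by
  have h := (((hasDerivAt_inv h0).comp_hasFDerivAt p hf.hasFDerivAt).mul hg.hasFDerivAt).fderiv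
  have h' : fderiv ℝ (fun q => (f q)⁻¹ * g q) p = _ := h
  rw [h']
  simp
  ring

/-- Propagation of the differential constraints `σ_{A',I}` by the non-conservative system:
if `(τ, d, v, m_{A,I})` solves the symmetric non-conservative system, then
`σ_{A',I} = Σ_{i∈I}(−1)^{O_I(i)} ∂_i(τ⁻¹ m_{A',I∖{i}})` (with `σ_{∅,·} = 0`) satisfies the
linear transport system stated below. -/
theorem sigma_evolution (m n : ℕ)
    (Ω : Set (ℝ × (Fin n → ℝ))) (hΩ : IsOpen Ω)
    (τ : ℝ × (Fin n → ℝ) → ℝ)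
    (d : Fin m → ℝ × (Fin n → ℝ) → ℝ)
    (v : Fin n → ℝ × (Fin n → ℝ) → ℝ)
    (mf : Finset (Fin m) → Finset (Fin n) → ℝ × (Fin n → ℝ) → ℝ)
    (hmempty : mf ∅ ∅ = τ)
    (hτ : ContDiffOn ℝ (⊤ : ℕ∞) τ Ω)
    (hd : ∀ α, ContDiffOn ℝ (⊤ : ℕ∞) (d α) Ω)
    (hv : ∀ i, ContDiffOn ℝ (⊤ : ℕ∞) (v i) Ω)
    (hmf : ∀ A I, ContDiffOn ℝ (⊤ : ℕ∞) (mf A I) Ω)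
    (hτ0 : ∀ p ∈ Ω, τ p ≠ 0)
    (eq1 : ∀ p ∈ Ω,
      pt τ p + ∑ j, v j p * px j τ p - τ p * ∑ j, px j (v j) p = 0)
    (eq2 : ∀ p ∈ Ω, ∀ α,
      pt (d α) p + ∑ i, v i p * px i (d α) p +
      (∑ A : Finset (Fin m), ∑ I : Finset (Fin n), ∑ i,
        if A.card = I.card ∧ α ∈ A ∧ i ∈ I then
          (-1 : ℝ) ^ (ordIdx A α + ordIdx I i) *
            mf (A.erase α) (I.erase i) p * px i (mf A I) p
        else 0) = 0)
    (eq3 : ∀ p ∈ Ω, ∀ i,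
      pt (v i) p +
      (∑ A : Finset (Fin m), ∑ I : Finset (Fin n), ∑ j,
        if A.card = I.card ∧ j ∈ I ∧ i ∉ I.erase j then
          (-1 : ℝ) ^ (ordIdx I j + ordIdx (I.erase j) i) *
            mf A (insert i (I.erase j)) p * px j (mf A I) p
        else 0) -
      (∑ A : Finset (Fin m), ∑ I : Finset (Fin n),
        if A.card = I.card ∧ 1 ≤ A.card then mf A I p * px i (mf A I) p else 0) +
      ∑ j, v j p * px j (v i) p - τ p * px i τ p = 0)
    (eq4 : ∀ p ∈ Ω, ∀ (A : Finset (Fin m)) (I : Finset (Fin n)),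
      A.card = I.card → 1 ≤ A.card →
      pt (mf A I) p + ∑ j, v j p * px j (mf A I) p +
      (∑ i, ∑ j, if i ∈ I ∧ j ∉ I.erase i then
          (-1 : ℝ) ^ (ordIdx (I.erase i) j + ordIdx I i) *
            mf A (insert j (I.erase i)) p * px i (v j) p
        else 0) -
      mf A I p * ∑ j, px j (v j) p +
      (∑ α, ∑ i, if α ∈ A ∧ i ∈ I then
          (-1 : ℝ) ^ (ordIdx A α + ordIdx I i) *
            mf (A.erase α) (I.erase i) p * px i (d α) p
        else 0) = 0)
    (σ : Finset (Fin m) → Finset (Fin n) → ℝ × (Fin n → ℝ) → ℝ)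
    (hσ : ∀ A' I, σ A' I = fun p =>
      if A' = ∅ then 0 else
        ∑ i ∈ I, (-1 : ℝ) ^ (ordIdx I i) *
          px i (fun q => (τ q)⁻¹ * mf A' (I.erase i) q) p) :
    ∀ p ∈ Ω, ∀ (A' : Finset (Fin m)) (I : Finset (Fin n)),
      I.card = A'.card + 1 → 2 ≤ I.card →
      pt (σ A' I) p =
        - ∑ j, v j p * px j (σ A' I) p
        + (∑ α, ∑ i, if α ∈ A' ∧ i ∈ I then
            (-1 : ℝ) ^ (ordIdx A' α + ordIdx I i) *
              σ (A'.erase α) (I.erase i) p * px i (d α) p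
          else 0)
        - (∑ i, ∑ j, if i ∈ I ∧ j ∉ I.erase i then
            (-1 : ℝ) ^ (ordIdx (I.erase i) j + ordIdx I i) *
              σ A' (insert j (I.erase i)) p * px i (v j) p
          else 0) := by
  intro p hp A' I hcard hI
  let w : Finset (Fin m) → ℝ × (Fin n → ℝ) → Finset (Fin n) → ℝ :=
    fun A q J => if A.card = J.card then (τ q)⁻¹ * mf A J q else 0
  let u : Fin m → ℝ × (Fin n → ℝ) → Finset (Fin n) → ℝ :=
    fun α q => if α ∈ A' then (-1 : ℝ) ^ ordIdx A' α • w (A'.erase α) q else 0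
  let e : Fin n → ℝ × (Fin n → ℝ) := fun i => (0, Pi.single i 1)
  let S : (ℝ × (Fin n → ℝ) → Finset (Fin n) → ℝ) → ℝ × (Fin n → ℝ) → Finset (Fin n) → ℝ :=
    fun f q => ∑ k, wedgeOp k (fderiv ℝ f q (e k))
  have hw : ∀ A, ContDiffOn ℝ (⊤ : ℕ∞) (w A) Ω := by
    intro A
    rw [contDiffOn_pi]
    intro J
    by_cases h : A.card = J.card
    · simp only [w, h, if_true]
      exact (hτ.inv hτ0).mul (hmf A J)
    · simpa only [w, h, if_false] using contDiffOn_const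
  have hu : ∀ α, ContDiffOn ℝ (⊤ : ℕ∞) (u α) Ω := by
    intro α
    by_cases h : α ∈ A'
    · simp only [u, h, if_true]
      exact (contDiffOn_const (c := (-1 : ℝ) ^ ordIdx A' α)).smul (hw (A'.erase α))
    · simpa only [u, h, if_false] using contDiffOn_const
  have hwd : ∀ A, ∀ q ∈ Ω, DifferentiableAt ℝ (w A) q := fun A q hq =>
    ((hw A).contDiffAt (hΩ.mem_nhds hq)).differentiableAt_of_top
  have hwcoord : ∀ A J, ∀ q ∈ Ω, A.card = J.card → ∀ a, fderiv ℝ (w A) q a J =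
      fderiv ℝ (fun q => (τ q)⁻¹ * mf A J q) q a := by
    intro A J q hq h a
    rw [fderiv_apply_coord (hwd A q hq)]
    simp only [w, h, if_true]
  have hwcoord0 : ∀ A J, ∀ q ∈ Ω, A.card ≠ J.card → ∀ a, fderiv ℝ (w A) q a J = 0 := by
    intro A J q hq h a
    rw [fderiv_apply_coord (hwd A q hq)]
    simp [w, h]
  have hWC : ∀ (f : Finset (Fin n) → ℝ) (J : Finset (Fin n)) (i j : Fin n),
      wedgeOp i (contractOp j f) J = if i ∈ J ∧ j ∉ J.erase i then
        (-1 : ℝ) ^ (ordIdx (J.erase i) j + ordIdx J i) * f (insert j (J.erase i)) else 0 := by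
    intro f J i j
    rw [wedgeOp_apply, contractOp_apply]
    by_cases hi : i ∈ J <;> by_cases hj : j ∈ J.erase i <;> simp only [hi, hj, not_true_eq_false,
      not_false_eq_true, and_self, and_false, and_true, if_true, if_false, mul_zero, pow_add]
    ring
  have hcardins : ∀ (J : Finset (Fin n)) (i j : Fin n), i ∈ J → j ∉ J.erase i →
      (insert j (J.erase i)).card = J.card := by
    intro J i j hi hj
    rw [Finset.card_insert_of_notMem hj, Finset.card_erase_add_one hi]
  have hA'card : 1 ≤ A'.card := by omega
  have H : ∀ q ∈ Ω, fderiv ℝ (w A') q (1, 0) + ∑ j, v j q • fderiv ℝ (w A') q (e j)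
      + ∑ i, ∑ j, fderiv ℝ (v j) q (e i) • wedgeOp i (contractOp j (w A' q))
      + ∑ α, ∑ i, fderiv ℝ (d α) q (e i) • wedgeOp i (u α q) = 0 := by
    intro q hq
    ext J
    simp only [Pi.add_apply, Finset.sum_apply, Pi.smul_apply, smul_eq_mul, Pi.zero_apply, hWC]
    by_cases h : A'.card = J.card
    · have hτd := (hτ.contDiffAt (hΩ.mem_nhds hq)).differentiableAt_of_top
      have hmd := ((hmf A' J).contDiffAt (hΩ.mem_nhds hq)).differentiableAt_of_top
      have h0 := hτ0 q hq
      have hfd : ∀ a, fderiv ℝ (w A') q a J = (τ q)⁻¹ * fderiv ℝ (mf A' J) q a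
          - (τ q)⁻¹ ^ 2 * fderiv ℝ τ q a * mf A' J q := fun a => by
        rw [hwcoord A' J q hq h, fderiv_inv_mul_apply hτd hmd h0]
      have h1 : ∑ j, v j q * fderiv ℝ (w A') q (e j) J = (τ q)⁻¹ * ∑ j, v j q * px j (mf A' J) q
          - (τ q)⁻¹ ^ 2 * mf A' J q * ∑ j, v j q * px j τ q := by
        rw [Finset.mul_sum, Finset.mul_sum, ← Finset.sum_sub_distrib]
        refine Finset.sum_congr rfl fun j _ => ?_
        rw [hfd]; simp only [px, e]; ring
      have h2 : (∑ i, ∑ j, fderiv ℝ (v j) q (e i) * if i ∈ J ∧ j ∉ J.erase i then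
          (-1 : ℝ) ^ (ordIdx (J.erase i) j + ordIdx J i) * w A' q (insert j (J.erase i)) else 0)
          = (τ q)⁻¹ * ∑ i, ∑ j, if i ∈ J ∧ j ∉ J.erase i then
          (-1 : ℝ) ^ (ordIdx (J.erase i) j + ordIdx J i) *
            mf A' (insert j (J.erase i)) q * px i (v j) q else 0 := by
        simp only [Finset.mul_sum]
        refine Finset.sum_congr rfl fun i _ => Finset.sum_congr rfl fun j _ => ?_
        split_ifs with hij
        · simp only [w, hcardins J i j hij.1 hij.2, h, if_true, px, e]; ring
        · simp
      have h3 : ∑ α, ∑ i, fderiv ℝ (d α) q (e i) * wedgeOp i (u α q) J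
          = (τ q)⁻¹ * ∑ α, ∑ i, if α ∈ A' ∧ i ∈ J then
          (-1 : ℝ) ^ (ordIdx A' α + ordIdx J i) *
            mf (A'.erase α) (J.erase i) q * px i (d α) q else 0 := by
        simp only [Finset.mul_sum]
        refine Finset.sum_congr rfl fun α _ => Finset.sum_congr rfl fun i _ => ?_
        rw [wedgeOp_apply]
        by_cases hα : α ∈ A' <;> by_cases hi : i ∈ J
        · have hc : (A'.erase α).card = (J.erase i).card := by
            rw [Finset.card_erase_of_mem hα, Finset.card_erase_of_mem hi, h]
          simp only [u, w, hα, hi, hc, if_true, and_self, px, e, Pi.smul_apply, smul_eq_mul,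
            pow_add]
          ring
        all_goals simp [u, hα, hi]
      have E1 := eq1 q hq
      have E4 := eq4 q hq A' J h hA'card
      have hinv : (τ q)⁻¹ * τ q = 1 := inv_mul_cancel₀ h0
      rw [h1, h2, h3, hfd]
      simp only [pt] at E1 E4
      linear_combination (τ q)⁻¹ * E4 - (τ q)⁻¹ ^ 2 * mf A' J q * E1
        - (τ q)⁻¹ * mf A' J q * (∑ j, px j (v j) q) * hinv
    · rw [hwcoord0 A' J q hq h, Finset.sum_eq_zero, Finset.sum_eq_zero, Finset.sum_eq_zero]
      · simp
      · intro α _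
        refine Finset.sum_eq_zero fun i _ => ?_
        rw [wedgeOp_apply]
        by_cases hα : α ∈ A' <;> by_cases hi : i ∈ J
        · have hc : (A'.erase α).card ≠ (J.erase i).card := by
            have := Finset.card_erase_add_one hα
            have := Finset.card_erase_add_one hi
            omega
          simp only [u, w, hα, hi, hc, if_true, if_false, Pi.smul_apply, smul_zero, mul_zero]
        all_goals simp [u, hα, hi]
      · intro i _
        refine Finset.sum_eq_zero fun j _ => ?_
        split_ifs with hij
        · simp [w, hcardins J i j hij.1 hij.2, h]
        · simp
      · intro j _
        rw [hwcoord0 A' J q hq h, mul_zero]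
  have hSσ : ∀ A J, J.card = A.card + 1 → ∀ q ∈ Ω, σ A J q = S (w A) q J := by
    intro A J hJ q hq
    simp only [hσ, S, Finset.sum_apply, wedgeOp_apply]
    rw [← Finset.sum_filter, Finset.filter_univ_mem]
    by_cases hA : A = ∅
    · subst hA
      have hconst : w ∅ =ᶠ[nhds q] fun _ J => if J = ∅ then 1 else 0 := by
        refine Filter.eventually_of_mem (hΩ.mem_nhds hq) fun x hx => ?_
        ext K
        by_cases hK : K = ∅
        · subst hK; simp [w, hmempty, hτ0 x hx]
        · have : ¬ (∅ : Finset (Fin m)).card = K.card := by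
            rw [Finset.card_empty, eq_comm, Finset.card_eq_zero]; exact hK
          simp only [w, this, hK, if_false]
      rw [hconst.fderiv_eq]
      simp
    · rw [if_neg hA]
      refine Finset.sum_congr rfl fun i hi => ?_
      rw [hwcoord A _ q hq (by rw [Finset.card_erase_of_mem hi, hJ]; rfl)]
      rfl
  have hSd : DifferentiableAt ℝ (S (w A')) p := by
    refine DifferentiableAt.fun_sum fun k _ => ?_
    exact (wedgeOp k).differentiableAt.comp p
      (((hw A').contDiffAt (hΩ.mem_nhds hp)).fderiv_apply_const (e k)).differentiableAt_of_top
  have hσd : ∀ a, fderiv ℝ (σ A' I) p a = fderiv ℝ (S (w A')) p a I := by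
    intro a
    have h : σ A' I =ᶠ[nhds p] fun q => S (w A') q I :=
      Filter.eventually_of_mem (hΩ.mem_nhds hp) (hSσ A' I hcard)
    rw [fderiv_apply_coord hSd, h.fderiv_eq]
  have key := congrFun (exteriorDeriv_transport wedgeOp contractOp wedgeOp_anticomm
    contractOp_wedgeOp_add hΩ (1, 0) e v d (w A') u hv hd (hw A') hu H hp) I
  change fderiv ℝ (S (w A')) p (1, 0) I = (- ∑ j, v j p • fderiv ℝ (S (w A')) p (e j)
    + ∑ α, ∑ i, fderiv ℝ (d α) p (e i) • wedgeOp i (S (u α) p)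
    - ∑ i, ∑ j, fderiv ℝ (v j) p (e i) • wedgeOp i (contractOp j (S (w A') p))) I at key
  simp only [Pi.sub_apply, Pi.add_apply, Pi.neg_apply, Finset.sum_apply, Pi.smul_apply,
    smul_eq_mul, hWC, ← hσd] at key
  simp only [pt, px]
  rw [key]
  congr 1
  · congr 1
    refine Finset.sum_congr rfl fun α _ => Finset.sum_congr rfl fun i _ => ?_
    rw [wedgeOp_apply]
    by_cases hα : α ∈ A'
    · have hSu : S (u α) p = (-1 : ℝ) ^ ordIdx A' α • S (w (A'.erase α)) p := by
        simp only [S, u, hα, if_true, Finset.smul_sum]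
        refine Finset.sum_congr rfl fun k _ => ?_
        rw [fderiv_fun_const_smul (hwd _ p hp)]
        simp
      by_cases hi : i ∈ I
      · rw [hSσ (A'.erase α) (I.erase i) (by
          rw [Finset.card_erase_of_mem hi, Finset.card_erase_add_one hα]; omega) p hp, hSu]
        simp only [hα, hi, if_true, and_self, Pi.smul_apply, smul_eq_mul, pow_add, e]
        ring
      · simp [hi]
    · simp [S, u, hα]
  · refine Finset.sum_congr rfl fun i _ => Finset.sum_congr rfl fun j _ => ?_
    split_ifs with hij
    · rw [hSσ A' _ ((hcardins I i j hij.1 hij.2).trans hcard) p hp]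
      ring
    · simp
end

section
/- Let F : ℝ×ℝⁿ → ℝ^{m×n} and D : ℝ×ℝⁿ → ℝᵐ be smooth, set P_i = Σ_α F_{αi} D_α, ξ(F) = det(I_n + FᵀF), h = √(|D|² + |P|² + ξ(F)) > 0, and ξ'(F)_{αi} = ξ(F) Σ_j ((I_n+FᵀF)⁻¹)_{ij} F_{αj}. Assume (F,D) solves: ∂_t F_{αi} + ∂_i((D_α + Σ_j F_{αj}P_j)/h) = 0, ∂_t D_α + ∂_i((D_α P_i + ξ'(F)_{αi})/h) = 0, and ∂_j F_{αi} = ∂_i F_{αj} for all α,i,j (repeated indices summed). Then the momentum P satisfies the conservation law ∂_t P_i + Σ_j ∂_j( P_iP_j/h − ξ(F)((I_n+FᵀF)⁻¹)_{ij}/h ) = 0 for every i. -/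
open Matrix

theorem differentiable_fun_div {E : Type*} [NormedAddCommGroup E] [NormedSpace ℝ E] {f g : E → ℝ}
    (hf : Differentiable ℝ f) (hg : Differentiable ℝ g) (h0 : ∀ q, g q ≠ 0) :
    Differentiable ℝ fun q => f q / g q := by
  simp only [div_eq_mul_inv]
  exact hf.fun_mul (hg.fun_inv h0)

theorem fderiv_fun_sum_mul_apply {E κ : Type*} [NormedAddCommGroup E] [NormedSpace ℝ E]
    [Fintype κ] {f g : κ → E → ℝ} (hf : ∀ α, Differentiable ℝ (f α))
    (hg : ∀ α, Differentiable ℝ (g α)) (p v : E) :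
    fderiv ℝ (fun q => ∑ α, f α q * g α q) p v =
      ∑ α, (f α p * fderiv ℝ (g α) p v + g α p * fderiv ℝ (f α) p v) := by
  rw [fderiv_fun_sum fun α _ => (hf α p).fun_mul (hg α p)]
  simp only [_root_.sum_apply]
  refine Finset.sum_congr rfl fun α _ => ?_
  rw [fderiv_fun_mul (hf α p) (hg α p)]
  simp

section DetDerivative

variable {E : Type*} [NormedAddCommGroup E] [NormedSpace ℝ E] {ι : Type*}
  [Fintype ι] [DecidableEq ι]

theorem differentiable_matrix_det {M : E → Matrix ι ι ℝ}
    (hM : ∀ i j, Differentiable ℝ fun q => M q i j) :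
    Differentiable ℝ fun q => (M q).det := by
  simp only [Matrix.det_apply]
  refine Differentiable.fun_sum fun σ _ => Differentiable.const_smul ?_ _
  fun_prop

theorem differentiable_matrix_adjugate {M : E → Matrix ι ι ℝ}
    (hM : ∀ i j, Differentiable ℝ fun q => M q i j) (i j : ι) :
    Differentiable ℝ fun q => (M q).adjugate i j := by
  simp only [Matrix.adjugate_apply]
  refine differentiable_matrix_det fun k l => ?_
  by_cases hk : k = j
  · subst hk
    simp
  · simpa [hk] using hM k l

/-- The Jacobi formula for the derivative of a determinant. -/
theorem fderiv_matrix_det {M : E → Matrix ι ι ℝ}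
    (hM : ∀ i j, Differentiable ℝ fun q => M q i j) (p v : E) :
    fderiv ℝ (fun q => (M q).det) p v =
      ∑ i, ∑ j, (M p).adjugate j i * fderiv ℝ (fun q => M q i j) p v := by
  have hM' : HasFDerivAt M
      (ContinuousLinearMap.pi fun i => ContinuousLinearMap.pi fun j =>
        fderiv ℝ (fun q => M q i j) p) p := by
    refine hasFDerivAt_pi.2 fun i => hasFDerivAt_pi.2 fun j => (hM i j p).hasFDerivAt
  let d : ContinuousMultilinearMap ℝ (fun _ : ι => ι → ℝ) ℝ :=
    { (Matrix.detRowAlternating (R := ℝ) (n := ι)).toMultilinearMap with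
      cont := Continuous.matrix_det continuous_id }
  have hd := (d.hasFDerivAt (M p)).comp p hM'
  have : fderiv ℝ (fun q => (M q).det) p = _ := hd.fderiv
  rw [this]
  refine (d.linearDeriv_apply (M p) fun i j => fderiv ℝ (fun q => M q i j) p v).trans ?_
  refine Finset.sum_congr rfl fun i _ => ?_
  change ((M p).updateRow i fun j => fderiv ℝ (fun q => M q i j) p v).det = _
  rw [← Matrix.det_transpose, ← Matrix.updateCol_transpose, ← Matrix.cramer_apply,
    Matrix.cramer_eq_adjugate_mulVec, ← Matrix.adjugate_transpose]
  rfl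

end DetDerivative

section Gram

theorem differentiable_one_add_transpose_mul_self {E ι κ : Type*} [NormedAddCommGroup E]
    [NormedSpace ℝ E] [DecidableEq ι] [Fintype κ] {F : E → Matrix κ ι ℝ}
    (hF : ∀ α i, Differentiable ℝ fun q => F q α i) (i j : ι) :
    Differentiable ℝ fun q => (1 + (F q)ᵀ * F q : Matrix ι ι ℝ) i j := by
  simp only [Matrix.add_apply, Matrix.mul_apply, Matrix.transpose_apply]
  fun_prop

variable {ι κ : Type*} [Fintype ι] [DecidableEq ι] [Fintype κ]

theorem det_one_add_transpose_mul_self_ne_zero (A : Matrix κ ι ℝ) :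
    (1 + Aᵀ * A).det ≠ 0 := by
  have h : (1 + Aᵀ * A).PosDef :=
    Matrix.PosDef.one.add_posSemidef (Matrix.posSemidef_conjTranspose_mul_self A)
  exact h.det_pos.ne'

theorem adjugate_one_add_transpose_mul_self_comm (A : Matrix κ ι ℝ) (i j : ι) :
    (1 + Aᵀ * A).adjugate i j = (1 + Aᵀ * A).adjugate j i := by
  have h : (1 + Aᵀ * A)ᵀ = 1 + Aᵀ * A := by simp
  conv_lhs => rw [← h, ← Matrix.adjugate_transpose, Matrix.transpose_apply]

theorem det_mul_inv_one_add_transpose_mul_self (A : Matrix κ ι ℝ) (i j : ι) :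
    (1 + Aᵀ * A).det * (1 + Aᵀ * A : Matrix ι ι ℝ)⁻¹ i j = (1 + Aᵀ * A).adjugate i j := by
  rw [Matrix.inv_def, Matrix.smul_apply, smul_eq_mul, Ring.inverse_eq_inv', ← mul_assoc,
    mul_inv_cancel₀ (det_one_add_transpose_mul_self_ne_zero A), one_mul]

theorem sum_mul_adjugate_one_add_transpose_mul_self (A : Matrix κ ι ℝ) (i j : ι) :
    ∑ α, A α i * ∑ k, (1 + Aᵀ * A).adjugate j k * A α k =
      (if i = j then (1 + Aᵀ * A).det else 0) - (1 + Aᵀ * A).adjugate i j := by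
  have h := congrFun (congrFun (Matrix.adjugate_mul (1 + Aᵀ * A)) j) i
  rw [mul_add, mul_one, Matrix.add_apply, Matrix.smul_apply, Matrix.one_apply,
    Matrix.mul_apply] at h
  rw [adjugate_one_add_transpose_mul_self_comm A i j, eq_sub_iff_add_eq']
  simp only [smul_eq_mul, mul_ite, mul_one, mul_zero, eq_comm (a := j)] at h
  rw [← h]
  simp only [Matrix.mul_apply, Matrix.transpose_apply, Finset.mul_sum]
  rw [Finset.sum_comm]
  congr 1
  exact Finset.sum_congr rfl fun _ _ => Finset.sum_congr rfl fun _ _ => by ring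

variable {E : Type*} [NormedAddCommGroup E] [NormedSpace ℝ E]

theorem fderiv_det_one_add_transpose_mul_self {F : E → Matrix κ ι ℝ}
    (hF : ∀ α i, Differentiable ℝ fun q => F q α i) (p v : E) :
    fderiv ℝ (fun q => (1 + (F q)ᵀ * F q).det) p v =
      2 * ∑ α, ∑ i, (∑ j, (1 + (F p)ᵀ * F p).adjugate i j * F p α j) *
        fderiv ℝ (fun q => F q α i) p v := by
  have hG : ∀ i j, fderiv ℝ (fun q => (1 + (F q)ᵀ * F q : Matrix ι ι ℝ) i j) p v =
      ∑ α, (F p α i * fderiv ℝ (fun q => F q α j) p v +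
        F p α j * fderiv ℝ (fun q => F q α i) p v) := by
    intro i j
    simp only [Matrix.add_apply, Matrix.mul_apply, Matrix.transpose_apply]
    rw [fderiv_const_add]
    exact fderiv_fun_sum_mul_apply (fun α => hF α i) (fun α => hF α j) p v
  rw [fderiv_matrix_det (differentiable_one_add_transpose_mul_self hF)]
  simp only [hG, Finset.mul_sum, Finset.sum_mul, mul_add, Finset.sum_add_distrib, two_mul]
  congr 1
  · rw [Finset.sum_comm_cycle]
    refine Finset.sum_congr rfl fun α _ => ?_
    rw [Finset.sum_comm]
    exact Finset.sum_congr rfl fun _ _ => Finset.sum_congr rfl fun _ _ => by ring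
  · rw [Finset.sum_comm_cycle]
    refine Finset.sum_congr rfl fun α _ => Finset.sum_congr rfl fun _ _ =>
      Finset.sum_congr rfl fun _ _ => ?_
    rw [adjugate_one_add_transpose_mul_self_comm]
    ring

end Gram

section Energy

variable {E : Type*} [NormedAddCommGroup E] [NormedSpace ℝ E] {ι κ : Type*}
  [Fintype ι] [DecidableEq ι] [Fintype κ]

/-- Differential of the energy `h`, in the form dual to `h = ∑ α, D α * A α + ξ / h` with
`A α = (D α + ∑ j, F α j * P j) / h`. -/
theorem sum_mul_fderiv_flux_add_fderiv_det_div {F : E → Matrix κ ι ℝ} {D : E → κ → ℝ}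
    {P : E → ι → ℝ} {h : E → ℝ}
    (hF : ∀ α i, Differentiable ℝ fun q => F q α i) (hD : ∀ α, Differentiable ℝ fun q => D q α)
    (hP : ∀ q i, P q i = ∑ α, F q α i * D q α)
    (hh : Differentiable ℝ h) (h0 : ∀ q, h q ≠ 0)
    (hsq : ∀ q, h q * h q =
      ∑ α, D q α ^ 2 + ∑ i, P q i ^ 2 + (1 + (F q)ᵀ * F q).det) (p v : E) :
    ∑ α, D p α * fderiv ℝ (fun q => (D q α + ∑ j, F q α j * P q j) / h q) p v +
        fderiv ℝ (fun q => (1 + (F q)ᵀ * F q).det / h q) p v =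
      ∑ α, ∑ i, (D p α * P p i + ∑ j, (1 + (F p)ᵀ * F p).adjugate i j * F p α j) / h p *
        fderiv ℝ (fun q => F q α i) p v := by
  have hPd : ∀ i, Differentiable ℝ fun q => P q i := by
    intro i
    simp only [hP]
    fun_prop
  have hξ := differentiable_matrix_det (differentiable_one_add_transpose_mul_self hF)
  have hA : ∀ α, Differentiable ℝ fun q => (D q α + ∑ j, F q α j * P q j) / h q := by
    intro α
    have : Differentiable ℝ fun q => D q α + ∑ j, F q α j * P q j := by fun_prop
    exact differentiable_fun_div this hh h0
  have hξh : Differentiable ℝ fun q => (1 + (F q)ᵀ * F q).det / h q :=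
    differentiable_fun_div hξ hh h0
  have hPF : ∀ q, ∑ α, D q α * ∑ j, F q α j * P q j = ∑ j, P q j ^ 2 := by
    intro q
    simp only [Finset.mul_sum]
    rw [Finset.sum_comm]
    refine Finset.sum_congr rfl fun j _ => ?_
    rw [sq]
    nth_rewrite 2 [hP q j]
    rw [Finset.sum_mul]
    exact Finset.sum_congr rfl fun _ _ => by ring
  have hEuler : h = fun q => ∑ α, D q α * ((D q α + ∑ j, F q α j * P q j) / h q) +
      (1 + (F q)ᵀ * F q).det / h q := by
    funext q
    have e : ∑ α, D q α * ((D q α + ∑ j, F q α j * P q j) / h q) =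
        (∑ α, D q α ^ 2 + ∑ j, P q j ^ 2) / h q := by
      rw [← hPF q, ← Finset.sum_add_distrib, Finset.sum_div]
      exact Finset.sum_congr rfl fun _ _ => by ring
    rw [e, ← add_div, ← hsq, mul_div_assoc, div_self (h0 q), mul_one]
  have d1 : fderiv ℝ h p v =
      ∑ α, (D p α * fderiv ℝ (fun q => (D q α + ∑ j, F q α j * P q j) / h q) p v +
        (D p α + ∑ j, F p α j * P p j) / h p * fderiv ℝ (fun q => D q α) p v) +
      fderiv ℝ (fun q => (1 + (F q)ᵀ * F q).det / h q) p v := by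
    conv_lhs => rw [hEuler]
    rw [fderiv_fun_add (by fun_prop) (hξh p), _root_.add_apply]
    congr 1
    exact fderiv_fun_sum_mul_apply hD hA p v
  have dP : ∀ i, fderiv ℝ (fun q => P q i) p v =
      ∑ α, (F p α i * fderiv ℝ (fun q => D q α) p v +
        D p α * fderiv ℝ (fun q => F q α i) p v) := by
    intro i
    simp only [hP]
    exact fderiv_fun_sum_mul_apply (fun α => hF α i) hD p v
  have d2 : h p * fderiv ℝ h p v =
      ∑ α, D p α * fderiv ℝ (fun q => D q α) p v +
      ∑ i, P p i * fderiv ℝ (fun q => P q i) p v +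
      ∑ α, ∑ i, (∑ j, (1 + (F p)ᵀ * F p).adjugate i j * F p α j) *
        fderiv ℝ (fun q => F q α i) p v := by
    have e := congrArg (fun f => fderiv ℝ f p v) (funext hsq)
    have hsqd : ∀ {f : E → ℝ}, Differentiable ℝ f →
        fderiv ℝ (fun q => f q ^ 2) p v = 2 * (f p * fderiv ℝ f p v) := by
      intro f hf
      rw [fderiv_fun_pow 2 (hf p)]
      simp
      ring
    rw [show (fun q => h q * h q) = fun q => h q ^ 2 from funext fun q => (sq _).symm] at e
    simp only [hsqd hh] at e
    rw [fderiv_fun_add (by fun_prop) (hξ p), fderiv_fun_add (by fun_prop) (by fun_prop),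
      fderiv_fun_sum fun α _ => (hD α p).fun_pow 2,
      fderiv_fun_sum fun i _ => (hPd i p).fun_pow 2] at e
    simp only [_root_.add_apply, _root_.sum_apply,
      hsqd (hD _), hsqd (hPd _), fderiv_det_one_add_transpose_mul_self hF,
      ← Finset.mul_sum] at e
    linarith
  have e1 : ∑ i, P p i * fderiv ℝ (fun q => P q i) p v =
      ∑ α, (∑ j, F p α j * P p j) * fderiv ℝ (fun q => D q α) p v +
      ∑ α, ∑ i, D p α * P p i * fderiv ℝ (fun q => F q α i) p v := by
    simp only [dP, Finset.mul_sum, Finset.sum_mul]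
    rw [Finset.sum_comm, ← Finset.sum_add_distrib]
    refine Finset.sum_congr rfl fun α _ => ?_
    rw [← Finset.sum_add_distrib]
    exact Finset.sum_congr rfl fun _ _ => by ring
  have e2 : fderiv ℝ h p v =
      ∑ α, (D p α + ∑ j, F p α j * P p j) / h p * fderiv ℝ (fun q => D q α) p v +
      ∑ α, ∑ i, (D p α * P p i + ∑ j, (1 + (F p)ᵀ * F p).adjugate i j * F p α j) / h p *
        fderiv ℝ (fun q => F q α i) p v := by
    refine mul_left_cancel₀ (h0 p) ?_
    rw [d2, e1]
    simp only [mul_add, Finset.mul_sum (a := h p)]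
    simp only [← mul_assoc, mul_div_cancel₀ _ (h0 p)]
    simp only [add_mul, Finset.sum_add_distrib]
    ring
  rw [Finset.sum_add_distrib] at d1
  linarith

end Energy

/-- Conservation of the momentum: a solution of the extremal-surface system satisfies
`∂_t P_i + Σ_j ∂_j(P_iP_j/h − ξ(F)((I_n+FᵀF)⁻¹)_{ij}/h) = 0`. -/
theorem momentum_conservation (m n : ℕ)
    (F : ℝ × (Fin n → ℝ) → Matrix (Fin m) (Fin n) ℝ)
    (D : ℝ × (Fin n → ℝ) → Fin m → ℝ)
    (hF : ∀ α i, ContDiff ℝ (⊤ : ℕ∞) fun p => F p α i)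
    (hD : ∀ α, ContDiff ℝ (⊤ : ℕ∞) fun p => D p α)
    (P : ℝ × (Fin n → ℝ) → Fin n → ℝ)
    (hP : P = fun p i => ∑ α, F p α i * D p α)
    (h : ℝ × (Fin n → ℝ) → ℝ)
    (hh : h = fun p =>
      Real.sqrt (∑ α, (D p α) ^ 2 + ∑ i, (P p i) ^ 2 + (1 + (F p)ᵀ * F p).det))
    (hpos : ∀ p, 0 < h p)
    (xi' : ℝ × (Fin n → ℝ) → Fin m → Fin n → ℝ)
    (hxi' : xi' = fun p α i => (1 + (F p)ᵀ * F p).det *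
      ∑ j, ((1 : Matrix (Fin n) (Fin n) ℝ) + (F p)ᵀ * F p)⁻¹ i j * F p α j)
    (heqF : ∀ p (α : Fin m) (i : Fin n),
      pt (fun q => F q α i) p
        + px i (fun q => (D q α + ∑ j, F q α j * P q j) / h q) p = 0)
    (heqD : ∀ p (α : Fin m),
      pt (fun q => D q α) p
        + ∑ i, px i (fun q => (D q α * P q i + xi' q α i) / h q) p = 0)
    (hcurl : ∀ p (α : Fin m) (i j : Fin n),
      px j (fun q => F q α i) p = px i (fun q => F q α j) p) :
    ∀ p (i : Fin n), pt (fun q => P q i) p +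
      ∑ j, px j (fun q => P q i * P q j / h q -
        (1 + (F q)ᵀ * F q).det *
          ((1 : Matrix (Fin n) (Fin n) ℝ) + (F q)ᵀ * F q)⁻¹ i j / h q) p = 0 := by
  have hF' : ∀ α i, Differentiable ℝ fun q => F q α i :=
    fun α i => (hF α i).differentiable (by simp)
  have hD' : ∀ α, Differentiable ℝ fun q => D q α := fun α => (hD α).differentiable (by simp)
  have hP' : ∀ q i, P q i = ∑ α, F q α i * D q α := fun q i => by rw [hP]
  have hPd : ∀ i, Differentiable ℝ fun q => P q i := by
    intro i
    simp only [hP']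
    fun_prop
  have hG := differentiable_one_add_transpose_mul_self hF'
  have hξ := differentiable_matrix_det hG
  have hadj := differentiable_matrix_adjugate hG
  have h0 : ∀ q, h q ≠ 0 := fun q => (hpos q).ne'
  have harg : ∀ q, 0 < ∑ α, D q α ^ 2 + ∑ i, P q i ^ 2 + (1 + (F q)ᵀ * F q).det := by
    intro q
    have := hpos q
    rw [hh] at this
    exact Real.sqrt_pos.1 this
  have hsq : ∀ q, h q * h q = ∑ α, D q α ^ 2 + ∑ i, P q i ^ 2 + (1 + (F q)ᵀ * F q).det := by
    intro q
    rw [hh]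
    exact Real.mul_self_sqrt (harg q).le
  have hhd : Differentiable ℝ h := by
    rw [hh]
    exact Differentiable.sqrt (by fun_prop) fun q => (harg q).ne'
  have hxi : ∀ q α i, xi' q α i = ∑ j, (1 + (F q)ᵀ * F q).adjugate i j * F q α j := by
    intro q α i
    simp only [hxi', Finset.mul_sum]
    refine Finset.sum_congr rfl fun j _ => ?_
    rw [← mul_assoc, det_mul_inv_one_add_transpose_mul_self]
  have hB : ∀ α i, Differentiable ℝ fun q => (D q α * P q i + xi' q α i) / h q := by
    intro α i
    simp only [hxi]
    have : Differentiable ℝ fun q => D q α * P q i +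
      ∑ j, (1 + (F q)ᵀ * F q).adjugate i j * F q α j := by fun_prop
    exact differentiable_fun_div this hhd h0
  have hξh : Differentiable ℝ fun q => (1 + (F q)ᵀ * F q).det / h q :=
    differentiable_fun_div hξ hhd h0
  intro p i
  have hflux : ∀ j, (fun q => P q i * P q j / h q - (1 + (F q)ᵀ * F q).det *
      ((1 : Matrix (Fin n) (Fin n) ℝ) + (F q)ᵀ * F q)⁻¹ i j / h q) = fun q =>
      ∑ α, F q α i * ((D q α * P q j + xi' q α j) / h q) -
        (if i = j then (1 : ℝ) else 0) * ((1 + (F q)ᵀ * F q).det / h q) := by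
    intro j
    funext q
    have e1 : ∑ α, F q α i * ((D q α * P q j + xi' q α j) / h q) =
        (P q i * P q j + ∑ α, F q α i * xi' q α j) / h q := by
      rw [hP' q i, Finset.sum_mul, ← Finset.sum_add_distrib, Finset.sum_div]
      exact Finset.sum_congr rfl fun _ _ => by ring
    rw [e1]
    simp only [hxi, sum_mul_adjugate_one_add_transpose_mul_self,
      det_mul_inv_one_add_transpose_mul_self]
    split_ifs <;> ring
  have dT : ∀ j v, fderiv ℝ (fun q => P q i * P q j / h q - (1 + (F q)ᵀ * F q).det *
      ((1 : Matrix (Fin n) (Fin n) ℝ) + (F q)ᵀ * F q)⁻¹ i j / h q) p v =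
      ∑ α, (F p α i * fderiv ℝ (fun q => (D q α * P q j + xi' q α j) / h q) p v +
        (D p α * P p j + xi' p α j) / h p * fderiv ℝ (fun q => F q α i) p v) -
      (if i = j then (1 : ℝ) else 0) *
        fderiv ℝ (fun q => (1 + (F q)ᵀ * F q).det / h q) p v := by
    intro j v
    rw [hflux j, fderiv_fun_sub (by fun_prop) ((hξh p).const_mul _),
      fderiv_const_mul (hξh p), _root_.sub_apply]
    congr 1
    exact fderiv_fun_sum_mul_apply (fun α => hF' α i) (fun α => hB α j) p v
  have dPt : pt (fun q => P q i) p =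
      ∑ α, (F p α i * pt (fun q => D q α) p + D p α * pt (fun q => F q α i) p) := by
    simp only [hP', pt]
    exact fderiv_fun_sum_mul_apply (fun α => hF' α i) hD' p _
  have henergy := sum_mul_fderiv_flux_add_fderiv_det_div hF' hD' hP' hhd h0 hsq p
    (0, Pi.single i 1)
  simp only [← hxi] at henergy
  have hDt : ∀ α, pt (fun q => D q α) p =
      -∑ j, px j (fun q => (D q α * P q j + xi' q α j) / h q) p :=
    fun α => eq_neg_of_add_eq_zero_left (heqD p α)
  have hFt : ∀ α, pt (fun q => F q α i) p =
      -px i (fun q => (D q α + ∑ j, F q α j * P q j) / h q) p :=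
    fun α => eq_neg_of_add_eq_zero_left (heqF p α i)
  have dTx : ∑ j, px j (fun q => P q i * P q j / h q - (1 + (F q)ᵀ * F q).det *
      ((1 : Matrix (Fin n) (Fin n) ℝ) + (F q)ᵀ * F q)⁻¹ i j / h q) p =
      ∑ α, F p α i * ∑ j, px j (fun q => (D q α * P q j + xi' q α j) / h q) p +
      ∑ α, ∑ j, (D p α * P p j + xi' p α j) / h p * px i (fun q => F q α j) p -
      px i (fun q => (1 + (F q)ᵀ * F q).det / h q) p := by
    simp only [← hcurl p _ i]
    simp only [px, dT, Finset.sum_sub_distrib, Finset.sum_add_distrib, Finset.mul_sum,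
      ite_mul, one_mul, zero_mul, Finset.sum_ite_eq, Finset.mem_univ, if_true]
    congr 2 <;> exact Finset.sum_comm
  rw [dPt, dTx]
  simp only [hDt, hFt, mul_neg, Finset.sum_add_distrib, Finset.sum_neg_distrib]
  simp only [px] at henergy ⊢
  linarith
end
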